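/- H¹ error estimate for the tensor-product quasi-interpolation (the estimate used for the term T₂ in the proof of Theorem 3): there exists a constant C > 0, independent of N and of u, such that for every integer N ≥ 5 (with h = 1/N) and every u : ℝ² → ℝ of class C³ with bounded partial derivatives up to total order 3, |u − I_b u|_{H¹(Ω)} ≤ C · h² · ‖u‖_{H³(Ω̃)}, where Ω := [0,1]² and Ω̃ := [−2h, 1+2h]². -/

import Mathlib

open scoped BigOperators Classical

/-- Quadratic (and general degree) B-spline basis functions on the uniform knot
sequence `s_j = j*h`, defined by the Cox–de Boor recursion. -/
noncomputable def Nspl (h : ℝ) : ℕ → ℤ → ℝ → ℝ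
  | 0 => fun j s => if (j : ℝ) * h ≤ s ∧ s < ((j : ℝ) + 1) * h then 1 else 0
  | d + 1 => fun j s =>
      (s - (j : ℝ) * h) / (((d : ℝ) + 1) * h) * Nspl h d j s
      + ((((j : ℝ) + (d : ℝ) + 2) * h - s) / (((d : ℝ) + 1) * h)) * Nspl h d (j + 1) s

/-- The quasi-interpolation coefficients `(α₀, α₁, α₂) = (−1/8, 5/4, −1/8)`. -/
noncomputable def alphaC : Fin 3 → ℝ := ![-(1/8), 5/4, -(1/8)]

/-- The quasi-interpolation coefficient functional
`μ_j(f) = α₀ f(τ_j⁰) + α₁ f(τ_j¹) + α₂ f(τ_j²)` with `τ_j^k = (j+k+1/2)h`. -/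
noncomputable def muQ (h : ℝ) (f : ℝ → ℝ) (j : ℤ) : ℝ :=
  ∑ k : Fin 3, alphaC k * f (((j : ℝ) + ((k : ℕ) : ℝ) + 1 / 2) * h)

/-- The quadratic B-spline quasi-interpolation operator `I_b f = Σ_j μ_j(f) N_j`. -/
noncomputable def IbQ (h : ℝ) (f : ℝ → ℝ) (x : ℝ) : ℝ :=
  ∑' j : ℤ, muQ h f j * Nspl h 2 j x

/-- The `W^{3,∞}(ℝ)` norm: maximum over `0 ≤ m ≤ 3` of `sup_x |u^{(m)}(x)|`. -/
noncomputable def W3norm (u : ℝ → ℝ) : ℝ :=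
  ⨆ p : ℝ × Fin 4, |iteratedDeriv (p.2 : ℕ) u p.1|

/-- Tensor-product quadratic B-spline. -/
noncomputable def Bspl2 (h : ℝ) (i : ℤ × ℤ) (p : ℝ × ℝ) : ℝ :=
  Nspl h 2 i.1 p.1 * Nspl h 2 i.2 p.2

/-- Tensor-product quasi-interpolation coefficient functional. -/
noncomputable def muQ2 (h : ℝ) (f : ℝ × ℝ → ℝ) (i : ℤ × ℤ) : ℝ :=
  ∑ k : Fin 3, ∑ l : Fin 3, alphaC k * alphaC l *
    f (((i.1 : ℝ) + ((k : ℕ) : ℝ) + 1 / 2) * h, ((i.2 : ℝ) + ((l : ℕ) : ℝ) + 1 / 2) * h)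

/-- Tensor-product quadratic B-spline quasi-interpolation. -/
noncomputable def IbQ2 (h : ℝ) (f : ℝ × ℝ → ℝ) (p : ℝ × ℝ) : ℝ :=
  ∑' i : ℤ × ℤ, muQ2 h f i * Bspl2 h i p

/-- The `W^{3,∞}(ℝ²)` norm: maximum over partial derivatives of total order ≤ 3 of their sup. -/
noncomputable def W3norm2 (f : ℝ × ℝ → ℝ) : ℝ :=
  ⨆ p : (ℝ × ℝ) × Fin 4, ‖iteratedFDeriv ℝ (p.2 : ℕ) f p.1‖

/-- The domain `Ω = [0,1]²`. -/
noncomputable def OmSq : Set (ℝ × ℝ) := Set.Icc (0 : ℝ) 1 ×ˢ Set.Icc (0 : ℝ) 1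

/-- The `H¹` seminorm `|v|_{H¹(S)} = (∫_S |∇v|²)^{1/2}`. -/
noncomputable def semiH1 (S : Set (ℝ × ℝ)) (v : ℝ × ℝ → ℝ) : ℝ :=
  Real.sqrt (∫ x in S, ‖fderiv ℝ v x‖ ^ 2)

/-- The `H³` norm `‖v‖_{H³(S)} = (Σ_{|β| ≤ 3} ∫_S |∂^β v|²)^{1/2}`. -/
noncomputable def normH3 (S : Set (ℝ × ℝ)) (v : ℝ × ℝ → ℝ) : ℝ :=
  Real.sqrt (∑ m ∈ Finset.range 4, ∫ x in S, ‖iteratedFDeriv ℝ m v x‖ ^ 2)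

/-- The three nonzero quadratic B-splines on a cell, in the local coordinate of the cell. -/
noncomputable def cellB : Fin 3 → ℝ → ℝ :=
  ![fun θ => (1 - θ) ^ 2 / 2, fun θ => 1 / 2 + θ - θ ^ 2, fun θ => θ ^ 2 / 2]

/-- The derivatives of the local quadratic B-splines. -/
noncomputable def cellB' : Fin 3 → ℝ → ℝ :=
  ![fun θ => θ - 1, fun θ => 1 - 2 * θ, fun θ => θ]

/-- Weight of the node indexed by `q` in the quasi-interpolant at local coordinate `θ`. -/
noncomputable def nodeW (q : Fin 3 × Fin 3) (θ : ℝ) : ℝ := cellB q.1 θ * alphaC q.2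

/-- Derivative of the node weight. -/
noncomputable def nodeW' (q : Fin 3 × Fin 3) (θ : ℝ) : ℝ := cellB' q.1 θ * alphaC q.2

/-- Local coordinate of the node indexed by `q`. -/
noncomputable def nodeC (q : Fin 3 × Fin 3) : ℝ := ((q.1 : ℕ) : ℝ) + ((q.2 : ℕ) : ℝ) - 3 / 2

theorem hasDerivAt_nodeW (q : Fin 3 × Fin 3) (θ : ℝ) :
    HasDerivAt (nodeW q) (nodeW' q θ) θ := by
  have key : HasDerivAt (cellB q.1) (cellB' q.1 θ) θ := by
    obtain ⟨a, b⟩ := q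
    have hid := hasDerivAt_id' θ
    fin_cases a
    · exact ((((hid.const_sub 1).pow 2).div_const 2)).congr_deriv (by simp [cellB']; ring)
    · exact ((hid.const_add (1 / 2)).sub (hid.pow 2)).congr_deriv (by simp [cellB'])
    · exact ((hid.pow 2).div_const 2).congr_deriv (by simp [cellB'])
  exact key.mul_const _

theorem abs_alphaC_le (k : Fin 3) : |alphaC k| ≤ 5 / 4 := by
  fin_cases k <;> simp [alphaC, abs_le] <;> norm_num

theorem abs_nodeW_le (q : Fin 3 × Fin 3) {θ : ℝ} (h0 : 0 ≤ θ) (h1 : θ ≤ 1) :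
    |nodeW q θ| ≤ 5 / 4 := by
  have key : |cellB q.1 θ| ≤ 1 := by
    obtain ⟨a, b⟩ := q
    fin_cases a <;> simp [cellB, abs_le] <;> constructor <;> nlinarith
  rw [nodeW, abs_mul]
  nlinarith [abs_alphaC_le q.2, abs_nonneg (alphaC q.2), abs_nonneg (cellB q.1 θ)]

theorem abs_nodeW'_le (q : Fin 3 × Fin 3) {θ : ℝ} (h0 : 0 ≤ θ) (h1 : θ ≤ 1) :
    |nodeW' q θ| ≤ 5 / 4 := by
  have key : |cellB' q.1 θ| ≤ 1 := by
    obtain ⟨a, b⟩ := q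
    fin_cases a <;> simp [cellB', abs_le] <;> constructor <;> nlinarith
  rw [nodeW', abs_mul]
  nlinarith [abs_alphaC_le q.2, abs_nonneg (alphaC q.2), abs_nonneg (cellB' q.1 θ)]

theorem nodeC_mem (q : Fin 3 × Fin 3) : -2 ≤ nodeC q ∧ nodeC q ≤ 3 := by
  obtain ⟨a, b⟩ := q
  fin_cases a <;> fin_cases b <;> norm_num [nodeC]

theorem sum_nodeW (θ : ℝ) : ∑ q, nodeW q θ = 1 := by
  simp [Fintype.sum_prod_type, Fin.sum_univ_three, nodeW, cellB, alphaC]; ring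

theorem sum_nodeW_mul (θ : ℝ) : ∑ q, nodeW q θ * (nodeC q - θ) = 0 := by
  simp [Fintype.sum_prod_type, Fin.sum_univ_three, nodeW, nodeC, cellB, alphaC]; ring

theorem sum_nodeW' (θ : ℝ) : ∑ q, nodeW' q θ = 0 := by
  simp [Fintype.sum_prod_type, Fin.sum_univ_three, nodeW', cellB', alphaC]; ring

theorem sum_nodeW'_mul (θ : ℝ) : ∑ q, nodeW' q θ * (nodeC q - θ) = 1 := by
  simp [Fintype.sum_prod_type, Fin.sum_univ_three, nodeW', nodeC, cellB', alphaC]; ring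

theorem sum_nodeW'_mul_sq (θ : ℝ) : ∑ q, nodeW' q θ * (nodeC q - θ) ^ 2 = 0 := by
  simp [Fintype.sum_prod_type, Fin.sum_univ_three, nodeW', nodeC, cellB', alphaC]; ring

/-- On the cell `[ih, (i+1)h)`, the quadratic B-splines are given by the local ones. -/
theorem Nspl_two_on_cell {h s : ℝ} (hh : 0 < h) {i : ℤ} (h1 : i * h ≤ s) (h2 : s < (i + 1) * h)
    (j : ℤ) : Nspl h 2 j s =
      (if j = i - 2 then cellB 0 (s / h - i) else 0) +
      (if j = i - 1 then cellB 1 (s / h - i) else 0) +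
      (if j = i then cellB 2 (s / h - i) else 0) := by
  have key : ∀ j : ℤ, Nspl h 0 j s = if j = i then 1 else 0 := by
    intro j
    simp only [Nspl]
    refine if_congr ⟨?_, ?_⟩ rfl rfl
    · rintro ⟨a, b⟩
      have c1 : (j : ℝ) < i + 1 := lt_of_mul_lt_mul_right (a.trans_lt h2) hh.le
      have c2 : (i : ℝ) < j + 1 := lt_of_mul_lt_mul_right (h1.trans_lt b) hh.le
      norm_cast at c1 c2
      omega
    · rintro rfl
      exact ⟨h1, h2⟩
  have e2 : j + 1 + 1 = i ↔ j = i - 2 := by omega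
  have e1 : j + 1 = i ↔ j = i - 1 := by omega
  have hrec : ∀ (d : ℕ) (j : ℤ), Nspl h (d + 1) j s =
      (s - (j : ℝ) * h) / (((d : ℝ) + 1) * h) * Nspl h d j s
      + ((((j : ℝ) + (d : ℝ) + 2) * h - s) / (((d : ℝ) + 1) * h)) * Nspl h d (j + 1) s :=
    fun _ _ => rfl
  rw [hrec 1, hrec 0, hrec 0, key, key, key]
  simp only [e1, e2]
  by_cases c2 : j = i - 2
  · subst c2
    simp [cellB]
    field_simp
    ring
  by_cases c1 : j = i - 1
  · subst c1
    simp [cellB]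
    field_simp
    ring
  by_cases c0 : j = i
  · subst c0
    simp only [c1, c2, if_false, if_true, cellB]
    simp
    field_simp
    ring
  · simp [c0, c1, c2]

theorem Nspl_two_on_cell_shift {h s : ℝ} (hh : 0 < h) {i : ℤ} (h1 : i * h ≤ s)
    (h2 : s < (i + 1) * h) (a : Fin 3) :
    Nspl h 2 (i - 2 + (a : ℕ)) s = cellB a (s / h - i) := by
  rw [Nspl_two_on_cell hh h1 h2]
  fin_cases a
  · simp
  · have : i - 2 + 1 = i - 1 := by omega
    simp [this]
  · have h2 : ¬i = i - 2 := by omega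
    have h1 : ¬i = i - 1 := by omega
    simp [h1, h2]

theorem Nspl_two_eq_zero {h s : ℝ} (hh : 0 < h) {i : ℤ} (h1 : i * h ≤ s)
    (h2 : s < (i + 1) * h) (j : ℤ) (hj : ∀ a : Fin 3, i - 2 + (a : ℕ) ≠ j) :
    Nspl h 2 j s = 0 := by
  rw [Nspl_two_on_cell hh h1 h2]
  have h0 := hj 0
  have h1 := hj 1
  have h2 := hj 2
  simp at h0 h1 h2
  rw [if_neg, if_neg, if_neg] <;> first | simp | omega

/-- The tensor-product quasi-interpolant on a cell, as a finite tensor-product sum. -/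
theorem IbQ2_on_cell {h s t : ℝ} (hh : 0 < h) {i j : ℤ} (hs1 : i * h ≤ s)
    (hs2 : s < (i + 1) * h) (ht1 : j * h ≤ t) (ht2 : t < (j + 1) * h) (u : ℝ × ℝ → ℝ) :
    IbQ2 h u (s, t) = ∑ q, ∑ r, nodeW q (s / h - i) * nodeW r (t / h - j) *
      u ((i + nodeC q) * h, (j + nodeC r) * h) := by
  let g : Fin 3 × Fin 3 → ℤ × ℤ := fun a => (i - 2 + ((a.1 : ℕ) : ℤ), j - 2 + ((a.2 : ℕ) : ℤ))
  have hg : Function.Injective g := by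
    rintro ⟨a, b⟩ ⟨c, d⟩ hab
    simp only [g, Prod.mk.injEq] at hab
    ext <;> simp <;> omega
  have hsupp : Function.support (fun k : ℤ × ℤ => muQ2 h u k * Bspl2 h k (s, t)) ⊆
      Set.range g := by
    intro k hk
    by_contra hn
    apply hk
    simp only [Bspl2]
    by_cases c : ∀ a : Fin 3, i - 2 + ((a : ℕ) : ℤ) ≠ k.1
    · rw [Nspl_two_eq_zero hh hs1 hs2 _ c]; simp
    by_cases c' : ∀ a : Fin 3, j - 2 + ((a : ℕ) : ℤ) ≠ k.2
    · rw [Nspl_two_eq_zero hh ht1 ht2 _ c']; simp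
    push Not at c c'
    obtain ⟨a, ha⟩ := c
    obtain ⟨b, hb⟩ := c'
    exact absurd ⟨(a, b), by simp [g, ha, hb]⟩ hn
  rw [IbQ2, ← hg.tsum_eq hsupp, tsum_fintype]
  simp only [Fintype.sum_prod_type, Bspl2, g, Nspl_two_on_cell_shift hh hs1 hs2,
    Nspl_two_on_cell_shift hh ht1 ht2, muQ2, nodeW, Finset.sum_mul]
  refine Finset.sum_congr rfl fun a _ => ?_
  rw [Finset.sum_comm]
  refine Finset.sum_congr rfl fun k _ => Finset.sum_congr rfl fun b _ =>
    Finset.sum_congr rfl fun l _ => ?_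
  have e1 : (((i - 2 + ((a : ℕ) : ℤ) : ℤ) : ℝ) + ((k : ℕ) : ℝ) + 1 / 2) * h =
      (i + nodeC (a, k)) * h := by
    simp only [nodeC]; push_cast; ring
  have e2 : (((j - 2 + ((b : ℕ) : ℤ) : ℤ) : ℝ) + ((l : ℕ) : ℝ) + 1 / 2) * h =
      (j + nodeC (b, l)) * h := by
    simp only [nodeC]; push_cast; ring
  rw [e1, e2]
  ring

theorem abs_sub_le_integral {f f' G : ℝ → ℝ} (hf : ∀ y, HasDerivAt f (f' y) y)
    (hf' : Continuous f') (hG : Continuous G) (hfG : ∀ y, |f' y| ≤ G y) {A B x z : ℝ}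
    (hx : x ∈ Set.Icc A B) (hz : z ∈ Set.Icc A B) : |f z - f x| ≤ ∫ y in A..B, G y := by
  have aux : ∀ x z : ℝ, x ≤ z → x ∈ Set.Icc A B → z ∈ Set.Icc A B →
      |f z - f x| ≤ ∫ y in A..B, G y := by
    intro x z hxz hx hz
    rw [← intervalIntegral.integral_eq_sub_of_hasDerivAt (fun y _ => hf y)
      (hf'.intervalIntegrable _ _)]
    calc |∫ y in x..z, f' y| ≤ ∫ y in x..z, |f' y| :=
          intervalIntegral.abs_integral_le_integral_abs hxz
      _ ≤ ∫ y in x..z, G y := intervalIntegral.integral_mono_on hxz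
          (hf'.abs.intervalIntegrable _ _) (hG.intervalIntegrable _ _) fun y _ => hfG y
      _ ≤ ∫ y in A..B, G y := intervalIntegral.integral_mono_interval hx.1 hxz hz.2
          (Filter.Eventually.of_forall fun y => (abs_nonneg _).trans (hfG y))
          (hG.intervalIntegrable _ _)
  rcases le_total x z with c | c
  · exact aux x z c hx hz
  · rw [abs_sub_comm]
    exact aux z x c hz hx

/-- Mean value inequality: a bound for the derivative of a function vanishing at `x`
gives a bound of the function itself. -/
theorem abs_le_of_abs_deriv_le {R R' : ℝ → ℝ} (hR : ∀ y, HasDerivAt R (R' y) y)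
    {A B x z M : ℝ} (hx : x ∈ Set.Icc A B) (hz : z ∈ Set.Icc A B) (hRx : R x = 0)
    (hM : ∀ y ∈ Set.Icc A B, |R' y| ≤ M) : |R z| ≤ (B - A) * M := by
  have := (convex_Icc A B).norm_image_sub_le_of_norm_hasDerivWithin_le
    (fun y _ => (hR y).hasDerivWithinAt) hM hx hz
  rw [hRx, sub_zero, Real.norm_eq_abs, Real.norm_eq_abs] at this
  have h1 : |z - x| ≤ B - A := by
    rw [abs_le]; constructor <;> linarith [hx.1, hx.2, hz.1, hz.2]
  have h2 : 0 ≤ M := (abs_nonneg _).trans (hM x hx)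
  nlinarith

theorem abs_taylor_two_le {f f₁ f₂ G : ℝ → ℝ} (hf : ∀ y, HasDerivAt f (f₁ y) y)
    (hf₁ : ∀ y, HasDerivAt f₁ (f₂ y) y) (hf₂ : Continuous f₂) (hG : Continuous G)
    (hfG : ∀ y, |f₂ y| ≤ G y) {A B x z : ℝ} (hx : x ∈ Set.Icc A B) (hz : z ∈ Set.Icc A B) :
    |f z - f x - f₁ x * (z - x)| ≤ (B - A) * ∫ y in A..B, G y := by
  refine abs_le_of_abs_deriv_le (R := fun z => f z - f x - f₁ x * (z - x))
    (R' := fun z => f₁ z - f₁ x) (fun y => ?_) hx hz (by ring)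
    fun y hy => abs_sub_le_integral hf₁ hf₂ hG hfG hx hy
  exact (((hf y).sub_const _).sub (((hasDerivAt_id' y).sub_const x).const_mul _)).congr_deriv
    (by ring)

theorem abs_taylor_three_le {f f₁ f₂ f₃ G : ℝ → ℝ} (hf : ∀ y, HasDerivAt f (f₁ y) y)
    (hf₁ : ∀ y, HasDerivAt f₁ (f₂ y) y) (hf₂ : ∀ y, HasDerivAt f₂ (f₃ y) y)
    (hf₃ : Continuous f₃) (hG : Continuous G)
    (hfG : ∀ y, |f₃ y| ≤ G y) {A B x z : ℝ} (hx : x ∈ Set.Icc A B) (hz : z ∈ Set.Icc A B) :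
    |f z - f x - f₁ x * (z - x) - f₂ x * (z - x) ^ 2 / 2| ≤
      (B - A) * ((B - A) * ∫ y in A..B, G y) := by
  refine abs_le_of_abs_deriv_le (R := fun z => f z - f x - f₁ x * (z - x) -
      f₂ x * (z - x) ^ 2 / 2) (R' := fun z => f₁ z - f₁ x - f₂ x * (z - x)) (fun y => ?_)
    hx hz (by ring) fun y hy => abs_taylor_two_le hf₁ hf₂ hf₃ hG hfG hx hy
  exact ((((hf y).sub_const _).sub (((hasDerivAt_id' y).sub_const x).const_mul _)).sub
    (((((hasDerivAt_id' y).sub_const x).pow 2).const_mul _).div_const 2)).congr_deriv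
    (by simp; ring)

theorem abs_sum_mul_le {w R : Fin 3 × Fin 3 → ℝ} {M : ℝ} (hw : ∀ q, |w q| ≤ 5 / 4)
    (hR : ∀ q, |R q| ≤ M) : |∑ q, w q * R q| ≤ 12 * M := by
  have hM : 0 ≤ M := (abs_nonneg _).trans (hR 0)
  calc |∑ q, w q * R q| ≤ ∑ q : Fin 3 × Fin 3, |w q * R q| := Finset.abs_sum_le_sum_abs _ _
    _ ≤ ∑ q : Fin 3 × Fin 3, 5 / 4 * M := Finset.sum_le_sum fun q _ => by
        rw [abs_mul]
        exact mul_le_mul (hw q) (hR q) (abs_nonneg _) (by norm_num)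
    _ ≤ 12 * M := by simp; linarith

section Cell

variable {h a x : ℝ}

theorem mem_cell_patch (hh : 0 < h) (hx1 : a ≤ x) (hx2 : x ≤ a + h) :
    x ∈ Set.Icc (a - 2 * h) (a + 3 * h) := by
  constructor <;> linarith

theorem node_mem_cell_patch (hh : 0 < h) (q : Fin 3 × Fin 3) :
    a + nodeC q * h ∈ Set.Icc (a - 2 * h) (a + 3 * h) := by
  have := nodeC_mem q
  constructor <;> nlinarith

theorem local_coord_mem (hh : 0 < h) (hx1 : a ≤ x) (hx2 : x ≤ a + h) :
    0 ≤ (x - a) / h ∧ (x - a) / h ≤ 1 :=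
  ⟨div_nonneg (by linarith) hh.le, by rw [div_le_one hh]; linarith⟩

theorem node_sub (hh : 0 < h) (q : Fin 3 × Fin 3) :
    a + nodeC q * h - x = (nodeC q - (x - a) / h) * h := by
  field_simp
  ring

/-- One-dimensional `L^∞`–`W^{2,1}` error estimate for the quasi-interpolant on a cell. -/
theorem cell_value_error (hh : 0 < h) (hx1 : a ≤ x) (hx2 : x ≤ a + h)
    {f f₁ f₂ G : ℝ → ℝ} (hf : ∀ y, HasDerivAt f (f₁ y) y)
    (hf₁ : ∀ y, HasDerivAt f₁ (f₂ y) y) (hf₂ : Continuous f₂) (hG : Continuous G)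
    (hfG : ∀ y, |f₂ y| ≤ G y) :
    |f x - ∑ q, nodeW q ((x - a) / h) * f (a + nodeC q * h)| ≤
      60 * h * ∫ y in (a - 2 * h)..(a + 3 * h), G y := by
  obtain ⟨t0, t1⟩ := local_coord_mem hh hx1 hx2
  have key := abs_sum_mul_le (w := fun q => nodeW q ((x - a) / h)) (fun q => abs_nodeW_le q t0 t1)
    (fun q => abs_taylor_two_le hf hf₁ hf₂ hG hfG (mem_cell_patch hh hx1 hx2)
      (node_mem_cell_patch hh q))
  have e : ∑ q, nodeW q ((x - a) / h) * (f (a + nodeC q * h) - f x -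
      f₁ x * (a + nodeC q * h - x)) =
      ∑ q, nodeW q ((x - a) / h) * f (a + nodeC q * h) - f x := by
    have e1 : ∀ q, nodeW q ((x - a) / h) * (f (a + nodeC q * h) - f x -
        f₁ x * (a + nodeC q * h - x)) = nodeW q ((x - a) / h) * f (a + nodeC q * h) -
        f x * nodeW q ((x - a) / h) -
        f₁ x * h * (nodeW q ((x - a) / h) * (nodeC q - (x - a) / h)) := by
      intro q
      rw [node_sub hh]; ring
    simp only [e1, Finset.sum_sub_distrib, ← Finset.mul_sum, sum_nodeW, sum_nodeW_mul]
    ring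
  rw [e, abs_sub_comm] at key
  refine key.trans (le_of_eq ?_)
  ring

/-- One-dimensional `W^{1,∞}`–`W^{3,1}` error estimate for the quasi-interpolant on a cell. -/
theorem cell_deriv_error (hh : 0 < h) (hx1 : a ≤ x) (hx2 : x ≤ a + h)
    {f f₁ f₂ f₃ G : ℝ → ℝ} (hf : ∀ y, HasDerivAt f (f₁ y) y)
    (hf₁ : ∀ y, HasDerivAt f₁ (f₂ y) y) (hf₂ : ∀ y, HasDerivAt f₂ (f₃ y) y)
    (hf₃ : Continuous f₃) (hG : Continuous G) (hfG : ∀ y, |f₃ y| ≤ G y) :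
    |f₁ x - ∑ q, nodeW' q ((x - a) / h) / h * f (a + nodeC q * h)| ≤
      300 * h * ∫ y in (a - 2 * h)..(a + 3 * h), G y := by
  obtain ⟨t0, t1⟩ := local_coord_mem hh hx1 hx2
  have key := abs_sum_mul_le (w := fun q => nodeW' q ((x - a) / h))
    (fun q => abs_nodeW'_le q t0 t1)
    (fun q => abs_taylor_three_le hf hf₁ hf₂ hf₃ hG hfG (mem_cell_patch hh hx1 hx2)
      (node_mem_cell_patch hh q))
  have e : ∑ q, nodeW' q ((x - a) / h) * (f (a + nodeC q * h) - f x -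
      f₁ x * (a + nodeC q * h - x) - f₂ x * (a + nodeC q * h - x) ^ 2 / 2) =
      -h * (f₁ x - ∑ q, nodeW' q ((x - a) / h) / h * f (a + nodeC q * h)) := by
    have e1 : ∀ q, nodeW' q ((x - a) / h) * (f (a + nodeC q * h) - f x -
        f₁ x * (a + nodeC q * h - x) - f₂ x * (a + nodeC q * h - x) ^ 2 / 2) =
        h * (nodeW' q ((x - a) / h) / h * f (a + nodeC q * h)) -
        f x * nodeW' q ((x - a) / h) -
        f₁ x * h * (nodeW' q ((x - a) / h) * (nodeC q - (x - a) / h)) -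
        f₂ x * h ^ 2 / 2 * (nodeW' q ((x - a) / h) * (nodeC q - (x - a) / h) ^ 2) := by
      intro q
      rw [node_sub hh]; field_simp
    simp only [e1, Finset.sum_sub_distrib, ← Finset.mul_sum, sum_nodeW', sum_nodeW'_mul,
      sum_nodeW'_mul_sq]
    ring
  rw [e, abs_mul, abs_neg, abs_of_pos hh] at key
  refine le_of_mul_le_mul_left (key.trans (le_of_eq ?_)) hh
  ring

/-- Stability of the derivative of the quasi-interpolant on a cell. -/
theorem cell_deriv_stability (hh : 0 < h) (hx1 : a ≤ x) (hx2 : x ≤ a + h)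
    {f f₁ G : ℝ → ℝ} (hf : ∀ y, HasDerivAt f (f₁ y) y)
    (hf₁ : Continuous f₁) (hG : Continuous G) (hfG : ∀ y, |f₁ y| ≤ G y) :
    |∑ q, nodeW' q ((x - a) / h) / h * f (a + nodeC q * h)| ≤
      12 / h * ∫ y in (a - 2 * h)..(a + 3 * h), G y := by
  obtain ⟨t0, t1⟩ := local_coord_mem hh hx1 hx2
  have key := abs_sum_mul_le (w := fun q => nodeW' q ((x - a) / h))
    (fun q => abs_nodeW'_le q t0 t1)
    (fun q => abs_sub_le_integral hf hf₁ hG hfG (mem_cell_patch hh hx1 hx2)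
      (node_mem_cell_patch hh q))
  have e : ∑ q, nodeW' q ((x - a) / h) * (f (a + nodeC q * h) - f x) =
      h * (∑ q, nodeW' q ((x - a) / h) / h * f (a + nodeC q * h)) := by
    have e1 : ∀ q, nodeW' q ((x - a) / h) * (f (a + nodeC q * h) - f x) =
        h * (nodeW' q ((x - a) / h) / h * f (a + nodeC q * h)) -
        f x * nodeW' q ((x - a) / h) := by
      intro q
      field_simp
    simp only [e1, Finset.sum_sub_distrib, ← Finset.mul_sum, sum_nodeW']
    ring
  rw [e, abs_mul, abs_of_pos hh] at key
  refine le_of_mul_le_mul_left (key.trans (le_of_eq ?_)) hh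
  field_simp

end Cell

theorem sq_intervalIntegral_le {f : ℝ → ℝ} (hf : Continuous f) {A B : ℝ} (hAB : A < B) :
    (∫ y in A..B, f y) ^ 2 ≤ (B - A) * ∫ y in A..B, f y ^ 2 := by
  set c := (∫ y in A..B, f y) / (B - A) with hc
  have hBA : 0 < B - A := sub_pos.2 hAB
  have h0 : 0 ≤ ∫ y in A..B, (f y - c) ^ 2 :=
    intervalIntegral.integral_nonneg hAB.le fun y _ => sq_nonneg _
  have i1 : IntervalIntegrable (fun y => f y ^ 2) MeasureTheory.volume A B :=
    (hf.pow 2).intervalIntegrable _ _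
  have i2 : IntervalIntegrable (fun y => 2 * c * f y) MeasureTheory.volume A B :=
    (hf.const_mul _).intervalIntegrable _ _
  have e : ∫ y in A..B, (f y - c) ^ 2 =
      (∫ y in A..B, f y ^ 2) - 2 * c * (∫ y in A..B, f y) + (B - A) * c ^ 2 := by
    have : ∀ y, (f y - c) ^ 2 = f y ^ 2 - 2 * c * f y + c ^ 2 := fun y => by ring
    simp only [this]
    rw [intervalIntegral.integral_add (i1.sub i2) (by simp),
      intervalIntegral.integral_sub i1 i2, intervalIntegral.integral_const_mul]
    simp
  have hI : (∫ y in A..B, f y) = c * (B - A) := by rw [hc]; field_simp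
  rw [e, hI] at h0
  rw [hI]
  nlinarith

/-- Bound of one partial derivative of the tensor-product quasi-interpolation error on a cell. -/
theorem tensor_deriv_error {h a b x y : ℝ} (hh : 0 < h) (hx1 : a ≤ x) (hx2 : x ≤ a + h)
    (hy1 : b ≤ y) (hy2 : y ≤ b + h) {f f₁ f₁₁ f₁₁₁ f₁₂ f₁₂₂ G : ℝ → ℝ → ℝ}
    (hf : ∀ r t, HasDerivAt (fun r => f r t) (f₁ r t) r)
    (hf₁ : ∀ r t, HasDerivAt (fun r => f₁ r t) (f₁₁ r t) r)
    (hf₁₁ : ∀ r t, HasDerivAt (fun r => f₁₁ r t) (f₁₁₁ r t) r)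
    (hf₁₂ : ∀ r t, HasDerivAt (fun t => f₁ r t) (f₁₂ r t) t)
    (hf₁₂₂ : ∀ r t, HasDerivAt (fun t => f₁₂ r t) (f₁₂₂ r t) t)
    (cf₁ : Continuous (Function.uncurry f₁)) (cf₁₁₁ : Continuous (Function.uncurry f₁₁₁))
    (cf₁₂₂ : Continuous (Function.uncurry f₁₂₂)) (cG : Continuous (Function.uncurry G))
    (hG : ∀ r t, |f₁₁₁ r t| ≤ G r t) (hG' : ∀ r t, |f₁₂₂ r t| ≤ G r t) :
    (f₁ x y - ∑ q, ∑ r, nodeW' q ((x - a) / h) / h * nodeW r ((y - b) / h) *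
      f (a + nodeC q * h) (b + nodeC r * h)) ^ 2 ≤
    10 ^ 9 * (h ^ 3 * (∫ s in (a - 2 * h)..(a + 3 * h), G s y ^ 2) +
      h ^ 2 * ∫ s in (a - 2 * h)..(a + 3 * h), ∫ t in (b - 2 * h)..(b + 3 * h), G s t ^ 2) := by
  set H : ℝ → ℝ := fun s => ∫ t in (b - 2 * h)..(b + 3 * h), G s t with hH
  have cH : Continuous H :=
    intervalIntegral.continuous_parametric_intervalIntegral_of_continuous' cG _ _
  have cGy : Continuous fun s => G s y := cG.comp (Continuous.prodMk_left y)
  have b1 := cell_deriv_error hh hx1 hx2 (fun r => hf r y) (fun r => hf₁ r y)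
    (fun r => hf₁₁ r y) (cf₁₁₁.comp (Continuous.prodMk_left y)) cGy (fun r => hG r y)
  have b2 := cell_deriv_stability hh hx1 hx2
    (f := fun s => f s y - ∑ r, nodeW r ((y - b) / h) * f s (b + nodeC r * h))
    (f₁ := fun s => f₁ s y - ∑ r, nodeW r ((y - b) / h) * f₁ s (b + nodeC r * h))
    (G := fun s => 60 * h * H s)
    (fun s => (hf s y).sub (HasDerivAt.fun_sum fun r _ => (hf s _).const_mul _))
    (by
      refine Continuous.sub (cf₁.comp (Continuous.prodMk_left y)) (continuous_finsetSum _ ?_)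
      exact fun r _ => (cf₁.comp (Continuous.prodMk_left _)).const_mul _)
    (cH.const_mul _)
    (fun s => cell_value_error hh hy1 hy2 (fun t => hf₁₂ s t) (fun t => hf₁₂₂ s t)
      (cf₁₂₂.comp (Continuous.prodMk_right s)) (cG.comp (Continuous.prodMk_right s)) (hG' s))
  rw [intervalIntegral.integral_const_mul] at b2
  have s1 := sq_intervalIntegral_le cGy (show a - 2 * h < a + 3 * h by linarith)
  have s2 := sq_intervalIntegral_le cH (show a - 2 * h < a + 3 * h by linarith)
  have s3 : ∫ s in (a - 2 * h)..(a + 3 * h), H s ^ 2 ≤ ∫ s in (a - 2 * h)..(a + 3 * h),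
      5 * h * ∫ t in (b - 2 * h)..(b + 3 * h), G s t ^ 2 := by
    refine intervalIntegral.integral_mono_on (by linarith) ((cH.pow 2).intervalIntegrable _ _)
      ((Continuous.const_mul (intervalIntegral.continuous_parametric_intervalIntegral_of_continuous'
        (cG.pow 2) _ _) _).intervalIntegrable _ _) fun s _ => ?_
    refine (sq_intervalIntegral_le (cG.comp (Continuous.prodMk_right s))
      (show b - 2 * h < b + 3 * h by linarith)).trans (le_of_eq ?_)
    simp only [Function.comp_def, Function.uncurry]
    ring
  rw [intervalIntegral.integral_const_mul] at s3
  have e : f₁ x y - ∑ q, ∑ r, nodeW' q ((x - a) / h) / h * nodeW r ((y - b) / h) *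
      f (a + nodeC q * h) (b + nodeC r * h) =
      (f₁ x y - ∑ q, nodeW' q ((x - a) / h) / h * f (a + nodeC q * h) y) +
      ∑ q, nodeW' q ((x - a) / h) / h * (f (a + nodeC q * h) y -
        ∑ r, nodeW r ((y - b) / h) * f (a + nodeC q * h) (b + nodeC r * h)) := by
    simp only [mul_sub, Finset.sum_sub_distrib, Finset.mul_sum, mul_assoc]
    ring
  rw [e]
  set X := f₁ x y - ∑ q, nodeW' q ((x - a) / h) / h * f (a + nodeC q * h) y
  set Y := ∑ q, nodeW' q ((x - a) / h) / h * (f (a + nodeC q * h) y -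
        ∑ r, nodeW r ((y - b) / h) * f (a + nodeC q * h) (b + nodeC r * h))
  set P := ∫ s in (a - 2 * h)..(a + 3 * h), G s y
  set Q := ∫ s in (a - 2 * h)..(a + 3 * h), H s
  set P2 := ∫ s in (a - 2 * h)..(a + 3 * h), G s y ^ 2
  set Q2 := ∫ s in (a - 2 * h)..(a + 3 * h), ∫ t in (b - 2 * h)..(b + 3 * h), G s t ^ 2
  have e2 : 12 / h * (60 * h * Q) = 720 * Q := by field_simp; ring
  rw [e2] at b2
  have c1 : X ^ 2 ≤ (300 * h * P) ^ 2 := sq_le_sq' (abs_le.1 b1).1 (abs_le.1 b1).2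
  have c2 : Y ^ 2 ≤ (720 * Q) ^ 2 := sq_le_sq' (abs_le.1 b2).1 (abs_le.1 b2).2
  have hh2 : 0 < h ^ 2 := by positivity
  have d1 : (300 * h * P) ^ 2 ≤ 450000 * (h ^ 3 * P2) := by
    nlinarith [mul_le_mul_of_nonneg_left s1 hh2.le]
  have d2 : Q ^ 2 ≤ 25 * (h ^ 2 * Q2) := by
    nlinarith [mul_le_mul_of_nonneg_left s3 hh.le]
  have d3 : 0 ≤ h ^ 3 * P2 := by nlinarith [sq_nonneg (300 * h * P)]
  have d4 : 0 ≤ h ^ 2 * Q2 := by nlinarith [sq_nonneg Q]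
  nlinarith [sq_nonneg (X - Y)]

theorem hasDerivAt_iteratedFDeriv_line {E : Type*} [NormedAddCommGroup E] [NormedSpace ℝ E]
    {u : E → ℝ} {n : WithTop ℕ∞} (hu : ContDiff ℝ n u) {m : ℕ} (hm : m < n) (v : Fin m → E)
    {γ : ℝ → E} {e : E} {r : ℝ} (hγ : HasDerivAt γ e r) :
    HasDerivAt (fun r => iteratedFDeriv ℝ m u (γ r) v)
      (iteratedFDeriv ℝ (m + 1) u (γ r) (Fin.cons e v)) r := by
  have h1 := ((hu.differentiable_iteratedFDeriv hm) (γ r)).hasFDerivAt.comp_hasDerivAt r hγ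
  have h2 := (ContinuousMultilinearMap.apply ℝ (fun _ : Fin m => E) ℝ v).hasFDerivAt.comp_hasDerivAt
    r h1
  refine h2.congr_deriv ?_
  simp [iteratedFDeriv_succ_apply_left]

theorem abs_iteratedFDeriv_apply_le {E : Type*} [NormedAddCommGroup E] [NormedSpace ℝ E]
    (u : E → ℝ) {m : ℕ} (p : E) {v : Fin m → E} (hv : ∀ i, ‖v i‖ ≤ 1) :
    |iteratedFDeriv ℝ m u p v| ≤ ‖iteratedFDeriv ℝ m u p‖ := by
  refine ((iteratedFDeriv ℝ m u p).le_opNorm v).trans ?_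
  exact mul_le_of_le_one_right (norm_nonneg _) (Finset.prod_le_one (fun _ _ => norm_nonneg _)
    fun i _ => hv i)

/-- Bound of the derivative of the tensor-product quasi-interpolation error along the first of
two directions. -/
theorem tensor_fderiv_error {h a b x y : ℝ} (hh : 0 < h) (hx1 : a ≤ x) (hx2 : x ≤ a + h)
    (hy1 : b ≤ y) (hy2 : y ≤ b + h) {u : ℝ × ℝ → ℝ} (hu : ContDiff ℝ 3 u) {e e' : ℝ × ℝ}
    (he : ‖e‖ ≤ 1) (he' : ‖e'‖ ≤ 1) :
    (fderiv ℝ u (x • e + y • e') e -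
      ∑ q, ∑ r, nodeW' q ((x - a) / h) / h * nodeW r ((y - b) / h) *
      u ((a + nodeC q * h) • e + (b + nodeC r * h) • e')) ^ 2 ≤
    10 ^ 9 * (h ^ 3 * (∫ s in (a - 2 * h)..(a + 3 * h),
        ‖iteratedFDeriv ℝ 3 u (s • e + y • e')‖ ^ 2) +
      h ^ 2 * ∫ s in (a - 2 * h)..(a + 3 * h), ∫ t in (b - 2 * h)..(b + 3 * h),
        ‖iteratedFDeriv ℝ 3 u (s • e + t • e')‖ ^ 2) := by
  have d1 : ∀ r t : ℝ, HasDerivAt (fun r : ℝ => r • e + t • e') e r := fun r t => by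
    simpa using ((hasDerivAt_id' r).smul_const e).add_const (t • e')
  have d2 : ∀ r t : ℝ, HasDerivAt (fun t : ℝ => r • e + t • e') e' t := fun r t => by
    simpa using ((hasDerivAt_id' t).smul_const e').const_add (r • e)
  have c : Continuous fun p : ℝ × ℝ => p.1 • e + p.2 • e' := by fun_prop
  have cD : ∀ m : ℕ, (m : WithTop ℕ∞) ≤ 3 → ∀ v : Fin m → ℝ × ℝ,
      Continuous (Function.uncurry fun r t : ℝ => iteratedFDeriv ℝ m u (r • e + t • e') v) := by
    intro m hm v
    exact (ContinuousMultilinearMap.apply ℝ (fun _ : Fin m => ℝ × ℝ) ℝ v).continuous.comp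
      ((hu.continuous_iteratedFDeriv hm).comp c :
        Continuous fun p : ℝ × ℝ => iteratedFDeriv ℝ m u (p.1 • e + p.2 • e'))
  have key := tensor_deriv_error hh hx1 hx2 hy1 hy2
    (f := fun r t => iteratedFDeriv ℝ 0 u (r • e + t • e') ![])
    (f₁ := fun r t => iteratedFDeriv ℝ 1 u (r • e + t • e') ![e])
    (f₁₁ := fun r t => iteratedFDeriv ℝ 2 u (r • e + t • e') ![e, e])
    (f₁₁₁ := fun r t => iteratedFDeriv ℝ 3 u (r • e + t • e') ![e, e, e])
    (f₁₂ := fun r t => iteratedFDeriv ℝ 2 u (r • e + t • e') ![e', e])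
    (f₁₂₂ := fun r t => iteratedFDeriv ℝ 3 u (r • e + t • e') ![e', e', e])
    (G := fun r t => ‖iteratedFDeriv ℝ 3 u (r • e + t • e')‖)
    (fun r t => hasDerivAt_iteratedFDeriv_line hu (by norm_num) _ (d1 r t))
    (fun r t => hasDerivAt_iteratedFDeriv_line hu (by norm_num) _ (d1 r t))
    (fun r t => hasDerivAt_iteratedFDeriv_line hu (by norm_num) _ (d1 r t))
    (fun r t => hasDerivAt_iteratedFDeriv_line hu (by norm_num) _ (d2 r t))
    (fun r t => hasDerivAt_iteratedFDeriv_line hu (by norm_num) _ (d2 r t))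
    (cD 1 (by norm_num) _) (cD 3 le_rfl _) (cD 3 le_rfl _)
    ((hu.continuous_iteratedFDeriv (m := 3) le_rfl).comp c).norm
    (fun r t => abs_iteratedFDeriv_apply_le u _ fun i => by fin_cases i <;> simpa)
    (fun r t => abs_iteratedFDeriv_apply_le u _ fun i => by fin_cases i <;> simpa)
  simpa only [iteratedFDeriv_zero_apply, iteratedFDeriv_one_apply, Matrix.cons_val_zero] using key

theorem hasDerivWithinAt_IbQ2_fst {h s t : ℝ} (hh : 0 < h) {i j : ℤ} (hs1 : i * h ≤ s)
    (hs2 : s < (i + 1) * h) (ht1 : j * h ≤ t) (ht2 : t < (j + 1) * h) (u : ℝ × ℝ → ℝ) :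
    HasDerivWithinAt (fun r => IbQ2 h u (r, t)) (∑ q, ∑ r, nodeW' q (s / h - i) / h *
      nodeW r (t / h - j) * u ((i + nodeC q) * h, (j + nodeC r) * h)) (Set.Ici s) s := by
  have h1 : HasDerivAt (fun x => ∑ q, ∑ r, nodeW q (x / h - i) * nodeW r (t / h - j) *
      u ((i + nodeC q) * h, (j + nodeC r) * h)) (∑ q, ∑ r, nodeW' q (s / h - i) / h *
      nodeW r (t / h - j) * u ((i + nodeC q) * h, (j + nodeC r) * h)) s := by
    refine HasDerivAt.fun_sum fun q _ => HasDerivAt.fun_sum fun r _ => ?_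
    refine HasDerivAt.mul_const (HasDerivAt.mul_const ?_ _) _
    exact ((hasDerivAt_nodeW q _).comp s (((hasDerivAt_id' s).div_const h).sub_const _)).congr_deriv
      (by ring)
  refine h1.hasDerivWithinAt.congr_of_eventuallyEq ?_ (IbQ2_on_cell hh hs1 hs2 ht1 ht2 u)
  filter_upwards [self_mem_nhdsWithin, mem_nhdsWithin_of_mem_nhds (Iio_mem_nhds hs2)] with x hx hx'
  exact IbQ2_on_cell hh (hs1.trans hx) hx' ht1 ht2 u

theorem hasDerivWithinAt_IbQ2_snd {h s t : ℝ} (hh : 0 < h) {i j : ℤ} (hs1 : i * h ≤ s)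
    (hs2 : s < (i + 1) * h) (ht1 : j * h ≤ t) (ht2 : t < (j + 1) * h) (u : ℝ × ℝ → ℝ) :
    HasDerivWithinAt (fun r => IbQ2 h u (s, r)) (∑ r, ∑ q, nodeW' r (t / h - j) / h *
      nodeW q (s / h - i) * u ((i + nodeC q) * h, (j + nodeC r) * h)) (Set.Ici t) t := by
  have h1 : HasDerivAt (fun x => ∑ q, ∑ r, nodeW q (s / h - i) * nodeW r (x / h - j) *
      u ((i + nodeC q) * h, (j + nodeC r) * h)) (∑ q, ∑ r, nodeW q (s / h - i) *
      (nodeW' r (t / h - j) / h) * u ((i + nodeC q) * h, (j + nodeC r) * h)) t := by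
    refine HasDerivAt.fun_sum fun q _ => HasDerivAt.fun_sum fun r _ => ?_
    refine HasDerivAt.mul_const (HasDerivAt.const_mul _ ?_) _
    exact ((hasDerivAt_nodeW r _).comp t (((hasDerivAt_id' t).div_const h).sub_const _)).congr_deriv
      (by ring)
  rw [Finset.sum_comm]
  simp only [mul_comm (nodeW' _ _ / h)]
  refine h1.hasDerivWithinAt.congr_of_eventuallyEq ?_ (IbQ2_on_cell hh hs1 hs2 ht1 ht2 u)
  filter_upwards [self_mem_nhdsWithin, mem_nhdsWithin_of_mem_nhds (Iio_mem_nhds ht2)] with x hx hx'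
  exact IbQ2_on_cell hh hs1 hs2 (ht1.trans hx) hx' u

theorem fderiv_apply_eq_of_hasDerivWithinAt {f : ℝ × ℝ → ℝ} {p e : ℝ × ℝ} {γ : ℝ → ℝ × ℝ}
    {x d : ℝ} (hf : DifferentiableAt ℝ f p) (hγ : HasDerivAt γ e x) (hx : γ x = p)
    (hd : HasDerivWithinAt (fun r => f (γ r)) d (Set.Ici x) x) : fderiv ℝ f p e = d := by
  subst hx
  exact (uniqueDiffWithinAt_Ici x).eq_deriv _
    (hf.hasFDerivAt.comp_hasDerivAt x hγ).hasDerivWithinAt hd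

theorem norm_le_add_of_prod (L : ℝ × ℝ →L[ℝ] ℝ) : ‖L‖ ≤ |L (1, 0)| + |L (0, 1)| := by
  refine L.opNorm_le_bound (by positivity) fun v => ?_
  have e : L v = v.1 * L (1, 0) + v.2 * L (0, 1) := by
    rw [← smul_eq_mul, ← smul_eq_mul, ← map_smul, ← map_smul, ← map_add]
    simp
  rw [e, Real.norm_eq_abs]
  refine (abs_add_le _ _).trans ?_
  rw [abs_mul, abs_mul, add_mul, mul_comm |v.1|, mul_comm |v.2|]
  exact add_le_add (mul_le_mul_of_nonneg_left (norm_fst_le v) (abs_nonneg _))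
    (mul_le_mul_of_nonneg_left (norm_snd_le v) (abs_nonneg _))

/-- Pointwise bound of the gradient of the quasi-interpolation error on a cell. -/
theorem norm_fderiv_error_sq_le {h s t : ℝ} (hh : 0 < h) {i j : ℤ} (hs1 : i * h ≤ s)
    (hs2 : s < (i + 1) * h) (ht1 : j * h ≤ t) (ht2 : t < (j + 1) * h) {u : ℝ × ℝ → ℝ}
    (hu : ContDiff ℝ 3 u) :
    ‖fderiv ℝ (fun p => u p - IbQ2 h u p) (s, t)‖ ^ 2 ≤ 2 * 10 ^ 9 *
      (h ^ 3 * (∫ x in (i * h - 2 * h)..(i * h + 3 * h), ‖iteratedFDeriv ℝ 3 u (x, t)‖ ^ 2) +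
      h ^ 2 * (∫ x in (i * h - 2 * h)..(i * h + 3 * h), ∫ y in (j * h - 2 * h)..(j * h + 3 * h),
        ‖iteratedFDeriv ℝ 3 u (x, y)‖ ^ 2) +
      (h ^ 3 * (∫ y in (j * h - 2 * h)..(j * h + 3 * h), ‖iteratedFDeriv ℝ 3 u (s, y)‖ ^ 2) +
      h ^ 2 * (∫ y in (j * h - 2 * h)..(j * h + 3 * h), ∫ x in (i * h - 2 * h)..(i * h + 3 * h),
        ‖iteratedFDeriv ℝ 3 u (x, y)‖ ^ 2))) := by
  have b1 := tensor_fderiv_error hh hs1 (show s ≤ i * h + h by linarith) ht1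
    (show t ≤ j * h + h by linarith) hu (e := (1, 0)) (e' := (0, 1)) (by simp) (by simp)
  have b2 := tensor_fderiv_error hh ht1 (show t ≤ j * h + h by linarith) hs1
    (show s ≤ i * h + h by linarith) hu (e := (0, 1)) (e' := (1, 0)) (by simp) (by simp)
  simp only [Prod.smul_mk, Prod.mk_add_mk, smul_eq_mul, mul_one, mul_zero, add_zero,
    zero_add] at b1 b2
  have el : ∀ (x : ℝ) (k : ℤ), (x - k * h) / h = x / h - k := fun x k => by field_simp
  simp only [el, ← add_mul _ (nodeC _) h] at b1 b2
  by_cases hd : DifferentiableAt ℝ (fun p => u p - IbQ2 h u p) (s, t)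
  · have hdu : DifferentiableAt ℝ u (s, t) := (hu.differentiable (by norm_num)) _
    have g1 : HasDerivAt (fun r : ℝ => (r, t)) ((1 : ℝ), (0 : ℝ)) s :=
      (hasDerivAt_id' s).prodMk (hasDerivAt_const s t)
    have g2 : HasDerivAt (fun r : ℝ => (s, r)) ((0 : ℝ), (1 : ℝ)) t :=
      (hasDerivAt_const t s).prodMk (hasDerivAt_id' t)
    have k1 := fderiv_apply_eq_of_hasDerivWithinAt hd g1 rfl
      ((hdu.hasFDerivAt.comp_hasDerivAt s g1).hasDerivWithinAt.sub
        (hasDerivWithinAt_IbQ2_fst hh hs1 hs2 ht1 ht2 u))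
    have k2 := fderiv_apply_eq_of_hasDerivWithinAt hd g2 rfl
      ((hdu.hasFDerivAt.comp_hasDerivAt t g2).hasDerivWithinAt.sub
        (hasDerivWithinAt_IbQ2_snd hh hs1 hs2 ht1 ht2 u))
    rw [← k1] at b1
    rw [← k2] at b2
    set L := fderiv ℝ (fun p => u p - IbQ2 h u p) (s, t)
    have hL := norm_le_add_of_prod L
    have hL2 : ‖L‖ ^ 2 ≤ 2 * (L (1, 0) ^ 2 + L (0, 1) ^ 2) := by
      have := pow_le_pow_left₀ (norm_nonneg L) hL 2
      nlinarith [sq_abs (L (1, 0)), sq_abs (L (0, 1)), sq_nonneg (|L (1, 0)| - |L (0, 1)|)]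
    linarith
  · rw [fderiv_zero_of_not_differentiableAt hd]
    simp only [norm_zero]
    nlinarith [b1.trans' (sq_nonneg _), b2.trans' (sq_nonneg _)]

section Window

open MeasureTheory
open scoped ENNReal

/-- Indicator of `|x - s| ≤ 3h`. -/
noncomputable def window (h x s : ℝ) : ℝ≥0∞ := if |x - s| ≤ 3 * h then 1 else 0

theorem measurable_window (h : ℝ) : Measurable fun p : ℝ × ℝ => window h p.1 p.2 :=
  Measurable.ite (measurableSet_le (by fun_prop) measurable_const) measurable_const
    measurable_const

theorem lintegral_window_le (h s : ℝ) : ∫⁻ x, window h x s ≤ ENNReal.ofReal (6 * h) := by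
  have e : (fun x => window h x s) = (Set.Icc (s - 3 * h) (s + 3 * h)).indicator 1 := by
    ext x
    rw [window, Set.indicator_apply]
    refine if_congr ?_ rfl rfl
    rw [abs_le, Set.mem_Icc]
    constructor <;> rintro ⟨h1, h2⟩ <;> constructor <;> linarith
  rw [e, lintegral_indicator_one measurableSet_Icc, Real.volume_Icc]
  exact ENNReal.ofReal_le_ofReal (by linarith)

theorem lintegral_window_mul_le (h : ℝ) (I : Set ℝ) {F : ℝ → ℝ≥0∞} (hF : Measurable F) :
    ∫⁻ x in I, ∫⁻ s in I, window h x s * F s ≤ ENNReal.ofReal (6 * h) * ∫⁻ s in I, F s := by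
  have hm : Measurable fun p : ℝ × ℝ => window h p.1 p.2 * F p.2 :=
    (measurable_window h).mul (hF.comp measurable_snd)
  rw [lintegral_lintegral_swap hm.aemeasurable, ← lintegral_const_mul _ hF]
  refine lintegral_mono fun s => ?_
  have hs : Measurable fun x => window h x s := (measurable_window h).comp measurable_prodMk_right
  rw [lintegral_mul_const _ hs]
  gcongr
  exact (lintegral_mono' Measure.restrict_le_self le_rfl).trans (lintegral_window_le h s)

theorem ofReal_integral_le_window {h x A B : ℝ} {I : Set ℝ} (hAB : A ≤ B)
    (hI : Set.Icc A B ⊆ I) (hA : x - 3 * h ≤ A) (hB : B ≤ x + 3 * h) {g : ℝ → ℝ}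
    (hg : Continuous g) (hg0 : ∀ s, 0 ≤ g s) {F : ℝ → ℝ≥0∞}
    (hgF : ∀ s, ENNReal.ofReal (g s) ≤ F s) :
    ENNReal.ofReal (∫ s in A..B, g s) ≤ ∫⁻ s in I, window h x s * F s := by
  rw [intervalIntegral.integral_of_le hAB, ofReal_integral_eq_lintegral_ofReal
    ((intervalIntegrable_iff_integrableOn_Ioc_of_le hAB).1 (hg.intervalIntegrable _ _))
    (Filter.Eventually.of_forall hg0)]
  refine le_trans ?_ (lintegral_mono_set (Set.Ioc_subset_Icc_self.trans hI))
  refine setLIntegral_mono' measurableSet_Ioc fun s hs => ?_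
  rw [window, if_pos, one_mul]
  · exact hgF s
  · rw [abs_le]
    constructor <;> linarith [hs.1, hs.2]

/-- Average in the first variable over a window. -/
noncomputable def windowFst (h : ℝ) (I : Set ℝ) (F : ℝ × ℝ → ℝ≥0∞) (p : ℝ × ℝ) : ℝ≥0∞ :=
  ∫⁻ s in I, window h p.1 s * F (s, p.2)

/-- Average in both variables over a product of windows. -/
noncomputable def windowBoth (h : ℝ) (I : Set ℝ) (F : ℝ × ℝ → ℝ≥0∞) (p : ℝ × ℝ) : ℝ≥0∞ :=
  ∫⁻ s in I, window h p.1 s * ∫⁻ t in I, window h p.2 t * F (s, t)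

variable {F : ℝ × ℝ → ℝ≥0∞}

theorem measurable_windowFst (h : ℝ) (I : Set ℝ) (hF : Measurable F) :
    Measurable (windowFst h I F) := by
  refine Measurable.lintegral_prod_right' (f := fun q : (ℝ × ℝ) × ℝ =>
    window h q.1.1 q.2 * F (q.2, q.1.2)) ?_
  exact ((measurable_window h).comp (by fun_prop : Measurable fun q : (ℝ × ℝ) × ℝ =>
    (q.1.1, q.2))).mul (hF.comp (by fun_prop))

theorem measurable_window_inner (h : ℝ) (I : Set ℝ) (hF : Measurable F) :
    Measurable fun q : ℝ × ℝ => ∫⁻ t in I, window h q.2 t * F (q.1, t) := by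
  refine Measurable.lintegral_prod_right' (f := fun q : (ℝ × ℝ) × ℝ =>
    window h q.1.2 q.2 * F (q.1.1, q.2)) ?_
  exact ((measurable_window h).comp (by fun_prop : Measurable fun q : (ℝ × ℝ) × ℝ =>
    (q.1.2, q.2))).mul (hF.comp (by fun_prop))

theorem measurable_windowBoth (h : ℝ) (I : Set ℝ) (hF : Measurable F) :
    Measurable (windowBoth h I F) := by
  refine Measurable.lintegral_prod_right' (f := fun q : (ℝ × ℝ) × ℝ =>
    window h q.1.1 q.2 * ∫⁻ t in I, window h q.1.2 t * F (q.2, t)) ?_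
  exact ((measurable_window h).comp (by fun_prop : Measurable fun q : (ℝ × ℝ) × ℝ =>
    (q.1.1, q.2))).mul ((measurable_window_inner h I hF).comp
      (by fun_prop : Measurable fun q : (ℝ × ℝ) × ℝ => (q.2, q.1.2)))

theorem setLIntegral_prod_self (I : Set ℝ) (hF : Measurable F) :
    ∫⁻ p in I ×ˢ I, F p = ∫⁻ x in I, ∫⁻ y in I, F (x, y) := by
  rw [Measure.volume_eq_prod, ← Measure.prod_restrict, lintegral_prod _ hF.aemeasurable]

theorem setLIntegral_prod_self_symm (I : Set ℝ) (hF : Measurable F) :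
    ∫⁻ p in I ×ˢ I, F p = ∫⁻ y in I, ∫⁻ x in I, F (x, y) := by
  rw [Measure.volume_eq_prod, ← Measure.prod_restrict, lintegral_prod_symm _ hF.aemeasurable]

theorem lintegral_windowFst_le (h : ℝ) (I : Set ℝ) (hF : Measurable F) :
    ∫⁻ p in I ×ˢ I, windowFst h I F p ≤ ENNReal.ofReal (6 * h) * ∫⁻ p in I ×ˢ I, F p := by
  rw [setLIntegral_prod_self_symm I (measurable_windowFst h I hF),
    setLIntegral_prod_self_symm I hF, ← lintegral_const_mul _ hF.lintegral_prod_left']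
  exact lintegral_mono fun y => lintegral_window_mul_le h I (hF.comp measurable_prodMk_right)

theorem lintegral_windowBoth_le (h : ℝ) (I : Set ℝ) (hF : Measurable F) :
    ∫⁻ p in I ×ˢ I, windowBoth h I F p ≤
      ENNReal.ofReal (6 * h) * (ENNReal.ofReal (6 * h) * ∫⁻ p in I ×ˢ I, F p) := by
  rw [setLIntegral_prod_self I (measurable_windowBoth h I hF),
    setLIntegral_prod_self I hF, ← lintegral_const_mul _ hF.lintegral_prod_right']
  refine le_trans (lintegral_mono fun x => ?_) (lintegral_window_mul_le h I
    (hF.lintegral_prod_right'.const_mul _))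
  have hm : Measurable fun q : ℝ × ℝ => window h x q.2 * ∫⁻ t in I, window h q.1 t * F (q.2, t) :=
    ((measurable_window h).comp (by fun_prop : Measurable fun q : ℝ × ℝ => (x, q.2))).mul
      ((measurable_window_inner h I hF).comp measurable_swap)
  simp only [windowBoth]
  rw [lintegral_lintegral_swap hm.aemeasurable]
  refine lintegral_mono fun s => ?_
  have hs : Measurable fun y => ∫⁻ t in I, window h y t * F (s, t) :=
    (measurable_window_inner h I hF).comp measurable_prodMk_left
  rw [lintegral_const_mul _ hs]
  gcongr
  exact lintegral_window_mul_le h I (hF.comp measurable_prodMk_left)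

theorem setLIntegral_prod_self_swap (I : Set ℝ) (hF : Measurable F) :
    ∫⁻ p in I ×ˢ I, F p.swap = ∫⁻ p in I ×ˢ I, F p := by
  rw [setLIntegral_prod_self_symm I hF,
    setLIntegral_prod_self (F := fun p => F p.swap) I (hF.comp measurable_swap)]
  rfl

theorem setLIntegral_windows_le {h : ℝ} (hh : 0 < h) (I : Set ℝ) (hF : Measurable F) :
    ∫⁻ p in I ×ˢ I, ENNReal.ofReal (2 * 10 ^ 9) *
      (ENNReal.ofReal (h ^ 3) * windowFst h I F p + ENNReal.ofReal (h ^ 2) * windowBoth h I F p +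
      (ENNReal.ofReal (h ^ 3) * windowFst h I (F ∘ Prod.swap) p.swap +
        ENNReal.ofReal (h ^ 2) * windowBoth h I (F ∘ Prod.swap) p.swap)) ≤
    ENNReal.ofReal (10 ^ 12 * h ^ 4) * ∫⁻ p in I ×ˢ I, F p := by
  have key : ∀ {F : ℝ × ℝ → ℝ≥0∞}, Measurable F → ∫⁻ p in I ×ˢ I,
      (ENNReal.ofReal (h ^ 3) * windowFst h I F p + ENNReal.ofReal (h ^ 2) * windowBoth h I F p)
      ≤ ENNReal.ofReal (42 * h ^ 4) * ∫⁻ p in I ×ˢ I, F p := by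
    intro F hF
    rw [lintegral_add_left ((measurable_windowFst h I hF).const_mul _),
      lintegral_const_mul _ (measurable_windowFst h I hF),
      lintegral_const_mul _ (measurable_windowBoth h I hF)]
    refine (add_le_add (mul_le_mul_right (lintegral_windowFst_le h I hF) _)
      (mul_le_mul_right (lintegral_windowBoth_le h I hF) _)).trans (le_of_eq ?_)
    simp only [← mul_assoc]
    rw [← add_mul, ← ENNReal.ofReal_mul (by positivity), ← ENNReal.ofReal_mul (by positivity),
      ← ENNReal.ofReal_mul (by positivity), ← ENNReal.ofReal_add (by positivity) (by positivity)]
    ring_nf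
  have hm : ∀ {F : ℝ × ℝ → ℝ≥0∞}, Measurable F → Measurable fun p =>
      ENNReal.ofReal (h ^ 3) * windowFst h I F p + ENNReal.ofReal (h ^ 2) * windowBoth h I F p :=
    fun hF => ((measurable_windowFst h I hF).const_mul _).add
      ((measurable_windowBoth h I hF).const_mul _)
  have hFs : Measurable (F ∘ Prod.swap) := hF.comp measurable_swap
  have hms : Measurable fun p => ENNReal.ofReal (h ^ 3) * windowFst h I F p +
      ENNReal.ofReal (h ^ 2) * windowBoth h I F p +
      (ENNReal.ofReal (h ^ 3) * windowFst h I (F ∘ Prod.swap) p.swap +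
        ENNReal.ofReal (h ^ 2) * windowBoth h I (F ∘ Prod.swap) p.swap) :=
    (hm hF).add ((hm hFs).comp measurable_swap)
  rw [lintegral_const_mul _ hms, lintegral_add_left (hm hF)]
  have k1 := key hF
  have k2 := key hFs
  rw [← setLIntegral_prod_self_swap I (hm hFs)] at k2
  have e : ∫⁻ p in I ×ˢ I, (F ∘ Prod.swap) p = ∫⁻ p in I ×ˢ I, F p :=
    setLIntegral_prod_self_swap I hF
  rw [e] at k2
  refine (mul_le_mul_right (add_le_add k1 k2) _).trans ?_
  rw [← add_mul, ← mul_assoc, ← ENNReal.ofReal_add (by positivity) (by positivity),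
    ← ENNReal.ofReal_mul (by positivity)]
  refine mul_le_mul_left (ENNReal.ofReal_le_ofReal ?_) _
  nlinarith [pow_pos hh 4]

/-- The squared gradient of the error is dominated by window averages of the squared third
derivative. -/
theorem ofReal_norm_fderiv_error_sq_le {N : ℕ} {h : ℝ} (hN : 0 < N) (hh : h = 1 / N)
    {u : ℝ × ℝ → ℝ} (hu : ContDiff ℝ 3 u) {p : ℝ × ℝ} (hp : p ∈ Set.Ico (0 : ℝ) 1 ×ˢ Set.Ico 0 1)
    {I : Set ℝ} (hI : Set.Icc (-(2 * h)) (1 + 2 * h) ⊆ I)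
    (hF : F = fun p => ENNReal.ofReal (‖iteratedFDeriv ℝ 3 u p‖ ^ 2)) :
    ENNReal.ofReal (‖fderiv ℝ (fun p => u p - IbQ2 h u p) p‖ ^ 2) ≤
    ENNReal.ofReal (2 * 10 ^ 9) *
      (ENNReal.ofReal (h ^ 3) * windowFst h I F p + ENNReal.ofReal (h ^ 2) * windowBoth h I F p +
      (ENNReal.ofReal (h ^ 3) * windowFst h I (F ∘ Prod.swap) p.swap +
        ENNReal.ofReal (h ^ 2) * windowBoth h I (F ∘ Prod.swap) p.swap)) := by
  obtain ⟨s, t⟩ := p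
  have hN' : (0 : ℝ) < N := by exact_mod_cast hN
  have h0 : 0 < h := by rw [hh]; positivity
  have hNh : N * h = 1 := by rw [hh]; field_simp
  have cell : ∀ x : ℝ, x ∈ Set.Ico (0 : ℝ) 1 → ∃ i : ℤ, i * h ≤ x ∧ x < (i + 1) * h ∧
      Set.Icc (i * h - 2 * h) (i * h + 3 * h) ⊆ I := by
    intro x hx
    have f1 : (⌊x * N⌋ : ℝ) ≤ x * N := Int.floor_le _
    have f2 : x * N < ⌊x * N⌋ + 1 := Int.lt_floor_add_one _
    have ex : x * N * h = x := by rw [mul_assoc, hNh, mul_one]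
    have i0 : (0 : ℝ) ≤ ⌊x * N⌋ := by
      exact_mod_cast Int.floor_nonneg.2 (mul_nonneg hx.1 hN'.le)
    have i1 : (⌊x * N⌋ : ℝ) + 1 ≤ N := by
      have : ⌊x * N⌋ < (N : ℤ) := Int.floor_lt.2 (by push_cast; nlinarith [hx.2])
      exact_mod_cast this
    refine ⟨⌊x * N⌋, ?_, ?_, ?_⟩
    · nlinarith
    · nlinarith
    · refine (Set.Icc_subset_Icc ?_ ?_).trans hI <;> nlinarith
  obtain ⟨i, hs1, hs2, hsI⟩ := cell s hp.1
  obtain ⟨j, ht1, ht2, htI⟩ := cell t hp.2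
  have cG : Continuous fun p : ℝ × ℝ => ‖iteratedFDeriv ℝ 3 u p‖ ^ 2 :=
    ((hu.continuous_iteratedFDeriv (m := 3) le_rfl).norm).pow 2
  have cGs : Continuous fun p : ℝ × ℝ => ‖iteratedFDeriv ℝ 3 u p.swap‖ ^ 2 :=
    cG.comp continuous_swap
  have line : ∀ {x : ℝ} {i : ℤ}, i * h ≤ x → x < (i + 1) * h →
      Set.Icc (i * h - 2 * h) (i * h + 3 * h) ⊆ I → ∀ {g : ℝ → ℝ}, Continuous g →
      (∀ s, 0 ≤ g s) → ∀ {F : ℝ → ℝ≥0∞}, (∀ s, ENNReal.ofReal (g s) ≤ F s) →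
      ENNReal.ofReal (∫ s in (i * h - 2 * h)..(i * h + 3 * h), g s) ≤
        ∫⁻ s in I, window h x s * F s := by
    intro x i h1 h2 h3 g hg hg0 F hgF
    exact ofReal_integral_le_window (by linarith) h3 (by linarith) (by linarith) hg hg0 hgF
  have plane : ∀ {x y : ℝ} {i j : ℤ}, i * h ≤ x → x < (i + 1) * h →
      Set.Icc (i * h - 2 * h) (i * h + 3 * h) ⊆ I → j * h ≤ y → y < (j + 1) * h →
      Set.Icc (j * h - 2 * h) (j * h + 3 * h) ⊆ I → ∀ {g : ℝ × ℝ → ℝ}, Continuous g →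
      (∀ s, 0 ≤ g s) →
      ENNReal.ofReal (∫ s in (i * h - 2 * h)..(i * h + 3 * h),
        ∫ t in (j * h - 2 * h)..(j * h + 3 * h), g (s, t)) ≤
        windowBoth h I (fun p => ENNReal.ofReal (g p)) (x, y) := by
    intro x y i j h1 h2 h3 h4 h5 h6 g hg hg0
    refine line h1 h2 h3 (intervalIntegral.continuous_parametric_intervalIntegral_of_continuous'
      (f := fun s t => g (s, t)) hg _ _) (fun s => intervalIntegral.integral_nonneg (by linarith) fun t _ => hg0 _) fun s => ?_
    exact line h4 h5 h6 (hg.comp (Continuous.prodMk_right s)) (fun t => hg0 _) fun t => le_rfl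
  refine (ENNReal.ofReal_le_ofReal (norm_fderiv_error_sq_le h0 hs1 hs2 ht1 ht2 hu)).trans ?_
  rw [ENNReal.ofReal_mul (by norm_num)]
  refine mul_le_mul_right (ENNReal.ofReal_add_le.trans (add_le_add
    (ENNReal.ofReal_add_le.trans (add_le_add ?_ ?_))
    (ENNReal.ofReal_add_le.trans (add_le_add ?_ ?_)))) _ <;>
  rw [ENNReal.ofReal_mul (by positivity)] <;> refine mul_le_mul_right ?_ _ <;> subst hF
  · exact line hs1 hs2 hsI (cG.comp (Continuous.prodMk_left t)) (fun _ => sq_nonneg _)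
      fun _ => le_rfl
  · exact plane hs1 hs2 hsI ht1 ht2 htI cG fun _ => sq_nonneg _
  · exact line ht1 ht2 htI (cG.comp (Continuous.prodMk_right s)) (fun _ => sq_nonneg _)
      fun _ => le_rfl
  · exact plane ht1 ht2 htI hs1 hs2 hsI cGs fun _ => sq_nonneg _

theorem integral_fderiv_error_sq_le {N : ℕ} {h : ℝ} (hN : 0 < N) (hh : h = 1 / N)
    {u : ℝ × ℝ → ℝ} (hu : ContDiff ℝ 3 u) :
    ∫ x in OmSq, ‖fderiv ℝ (fun p => u p - IbQ2 h u p) x‖ ^ 2 ≤ 10 ^ 12 * h ^ 4 *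
      ∫ x in Set.Icc (-(2 * h)) (1 + 2 * h) ×ˢ Set.Icc (-(2 * h)) (1 + 2 * h),
        ‖iteratedFDeriv ℝ 3 u x‖ ^ 2 := by
  have h0 : 0 < h := by
    rw [hh]
    have : (0 : ℝ) < N := by exact_mod_cast hN
    positivity
  set I := Set.Icc (-(2 * h)) (1 + 2 * h) with hI
  have cG : Continuous fun p : ℝ × ℝ => ‖iteratedFDeriv ℝ 3 u p‖ ^ 2 :=
    ((hu.continuous_iteratedFDeriv (m := 3) le_rfl).norm).pow 2
  have hΩ : (OmSq : Set (ℝ × ℝ)) =ᵐ[volume] Set.Ico (0 : ℝ) 1 ×ˢ Set.Ico (0 : ℝ) 1 :=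
    Measure.set_prod_ae_eq Ico_ae_eq_Icc.symm Ico_ae_eq_Icc.symm
  have hsub : Set.Ico (0 : ℝ) 1 ×ˢ Set.Ico (0 : ℝ) 1 ⊆ I ×ˢ I := by
    have : Set.Ico (0 : ℝ) 1 ⊆ I := fun x hx => ⟨by linarith [hx.1], by linarith [hx.2]⟩
    exact Set.prod_mono this this
  have hFm : Measurable fun p : ℝ × ℝ => ENNReal.ofReal (‖iteratedFDeriv ℝ 3 u p‖ ^ 2) :=
    cG.measurable.ennreal_ofReal
  have hint : 0 ≤ ∫ x in I ×ˢ I, ‖iteratedFDeriv ℝ 3 u x‖ ^ 2 :=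
    integral_nonneg fun _ => sq_nonneg _
  rw [← ENNReal.ofReal_le_ofReal_iff (by positivity), setIntegral_congr_set hΩ,
    ENNReal.ofReal_mul (by positivity), ofReal_integral_eq_lintegral_ofReal
      (cG.continuousOn.integrableOn_compact (isCompact_Icc.prod isCompact_Icc))
      (Filter.Eventually.of_forall fun _ => sq_nonneg _)]
  refine le_trans ?_ (setLIntegral_windows_le h0 I hFm)
  refine le_trans ?_ (lintegral_mono_set hsub)
  refine le_trans ?_ (setLIntegral_mono' (measurableSet_Ico.prod measurableSet_Ico)
    fun p hp => ofReal_norm_fderiv_error_sq_le hN hh hu hp hI.ge rfl)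
  rw [integral_eq_lintegral_of_nonneg_ae (Filter.Eventually.of_forall fun _ => sq_nonneg _)
    ((measurable_fderiv ℝ _).norm.pow_const 2).aestronglyMeasurable]
  exact ENNReal.ofReal_toReal_le

end Window

/-- `H¹` error estimate for the tensor-product quadratic B-spline
quasi-interpolation: `|u − I_b u|_{H¹(Ω)} ≤ C h² ‖u‖_{H³(Ω̃)}` with `Ω = [0,1]²` and
`Ω̃ = [−2h, 1+2h]²`. -/
theorem stmt14 :
    ∃ C : ℝ, 0 < C ∧ ∀ N : ℕ, 5 ≤ N → ∀ h : ℝ, h = 1 / N →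
      ∀ u : ℝ × ℝ → ℝ,
        ContDiff ℝ 3 u →
        (∀ m : ℕ, m ≤ 3 → ∃ M : ℝ, ∀ x : ℝ × ℝ, ‖iteratedFDeriv ℝ m u x‖ ≤ M) →
        semiH1 OmSq (fun p => u p - IbQ2 h u p)
          ≤ C * h ^ 2 *
            normH3 (Set.Icc (-(2 * h)) (1 + 2 * h) ×ˢ Set.Icc (-(2 * h)) (1 + 2 * h)) u := by
  refine ⟨10 ^ 6, by norm_num, fun N hN h hh u hu _ => ?_⟩
  have key := integral_fderiv_error_sq_le (by omega : 0 < N) hh hu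
  have h0 : 0 ≤ h := by rw [hh]; positivity
  rw [semiH1, normH3]
  refine Real.sqrt_le_iff.2 ⟨by positivity, ?_⟩
  rw [mul_pow, Real.sq_sqrt (Finset.sum_nonneg fun m _ =>
    MeasureTheory.integral_nonneg fun _ => sq_nonneg _)]
  refine key.trans ?_
  have e : ((10 : ℝ) ^ 6 * h ^ 2) ^ 2 = 10 ^ 12 * h ^ 4 := by ring
  rw [e]
  refine mul_le_mul_of_nonneg_left ?_ (by positivity)
  exact Finset.single_le_sum (f := fun m => ∫ x in Set.Icc (-(2 * h)) (1 + 2 * h) ×ˢ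
      Set.Icc (-(2 * h)) (1 + 2 * h), ‖iteratedFDeriv ℝ m u x‖ ^ 2)
    (fun m _ => MeasureTheory.integral_nonneg fun _ => sq_nonneg _)
    (by simp : 3 ∈ Finset.range 4)
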